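/- arXiv:0908.0428 — 2 statements merged into one kernel-verified Lean document; each statement's English description precedes it below -/
import Mathlib

section
/- Let L be a join-semilattice and let A ⊆ L be such that A is itself a transversal of A. Then A_Cn ∖ ↑A = ∅, and A is the unique transversal of A. -/
open Set

/-- `upSet M = {x | ∃ m ∈ M, m ≤ x}`. -/
def upSet {L : Type*} [Preorder L] (M : Set L) : Set L := {x | ∃ m ∈ M, m ≤ x}

/-- `downSet M = {x | ∃ m ∈ M, x ≤ m}`. -/
def downSet {L : Type*} [Preorder L] (M : Set L) : Set L := {x | ∃ m ∈ M, x ≤ m}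

/-- A finite duality `(A, B)`: finite antichains such that
`x ∈ ↑A` iff `x ∉ ↓B`. -/
def FiniteDuality {L : Type*} [Preorder L] (A B : Set L) : Prop :=
  A.Finite ∧ B.Finite ∧ IsAntichain (· ≤ ·) A ∧ IsAntichain (· ≤ ·) B ∧
    ∀ x : L, (∃ a ∈ A, a ≤ x) ↔ ¬ ∃ b ∈ B, x ≤ b

/-- `(l, r)` is a duality pair if `¬ l ≤ x ↔ x ≤ r` for all `x`. -/
def DualityPair {L : Type*} [Preorder L] (l r : L) : Prop :=
  ∀ x : L, ¬ l ≤ x ↔ x ≤ r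

/-- An element is connected (join-prime) if `a ≤ b ⊔ c` implies `a ≤ b` or `a ≤ c`. -/
def ConnectedElt {L : Type*} [SemilatticeSup L] (a : L) : Prop :=
  ∀ b c : L, a ≤ b ⊔ c → a ≤ b ∨ a ≤ c

/-- `L` has finite connected decompositions: every element is the supremum of a
finite nonempty set of connected elements. -/
def HasFiniteConnectedDecompositions (L : Type*) [SemilatticeSup L] : Prop :=
  ∀ a : L, ∃ (F : Finset L) (h : F.Nonempty),
    (∀ c ∈ F, ConnectedElt c) ∧ F.sup' h id = a

/-- `c` is a connected component of `a`: `c` is connected and either `c = a` or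
there is `b` with `a = b ⊔ c ≠ b`. -/
def IsConnComponent {L : Type*} [SemilatticeSup L] (c a : L) : Prop :=
  ConnectedElt c ∧ (c = a ∨ ∃ b : L, a = b ⊔ c ∧ b ⊔ c ≠ b)

/-- `connComponents A` is the set of connected components of elements of `A`. -/
def connComponents {L : Type*} [SemilatticeSup L] (A : Set L) : Set L :=
  {c | ∃ a ∈ A, IsConnComponent c a}

/-- A quasitransversal of `A`: an antichain `M ⊆ A_Cn` with `A ⊆ ↑M`. -/
def IsQuasitransversal {L : Type*} [SemilatticeSup L] (M A : Set L) : Prop :=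
  M ⊆ connComponents A ∧ IsAntichain (· ≤ ·) M ∧ A ⊆ upSet M

/-- A transversal of `A`: a quasitransversal maximal in the refinement order
`M ⊴ N ↔ N ⊆ ↑M`. -/
def IsTransversal {L : Type*} [SemilatticeSup L] (M A : Set L) : Prop :=
  IsQuasitransversal M A ∧
    ∀ N : Set L, IsQuasitransversal N A → N ⊆ upSet M → N = M

/-- The set of weak left duals: elements of `A` for some finite duality `(A, B)`
with `B` nonempty. -/
def wld (L : Type*) [Preorder L] : Set L :=
  {a | ∃ A B : Set L, FiniteDuality A B ∧ B.Nonempty ∧ a ∈ A}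

/-- The sparse incomparability axiom. -/
def SIA (L : Type*) [Preorder L] : Prop :=
  ∀ (x : L) (M U : Set L), M.Finite → U.Finite →
    (insert x (upSet U)) ∩ wld L = ∅ →
    ∃ y : L, y ∉ wld L ∧ y ≤ x ∧ y ∉ upSet (insert x U) ∧
      ∀ m ∈ M, (y ≤ m ↔ x ≤ m)

theorem IsConnComponent.eq_of_connectedElt {L : Type*} [SemilatticeSup L] {c a : L}
    (h : IsConnComponent c a) (ha : ConnectedElt a) : c = a := by
  obtain ⟨-, rfl | ⟨b, hab, hb⟩⟩ := h
  · rfl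
  · rcases ha b c hab.le with h | h
    · exact absurd (le_antisymm (hab ▸ h) le_sup_left) hb
    · exact le_antisymm (hab ▸ le_sup_right) h

theorem connComponents_subset_self {L : Type*} [SemilatticeSup L] {A : Set L}
    (hA : ∀ a ∈ A, ConnectedElt a) : connComponents A ⊆ A := by
  rintro c ⟨a, ha, hc⟩
  rwa [hc.eq_of_connectedElt (hA a ha)]

/-- if `A` is a transversal of itself, then `A_Cn \ ↑A = ∅` and
`A` is the unique transversal of `A`. -/
theorem self_transversal {L : Type*} [SemilatticeSup L] (A : Set L)
    (hA : IsTransversal A A) :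
    connComponents A \ upSet A = ∅ ∧ ∀ N : Set L, IsTransversal N A → N = A := by
  obtain ⟨⟨hsub, hanti, -⟩, -⟩ := hA
  have hcomp : connComponents A ⊆ A := connComponents_subset_self fun a ha => by
    obtain ⟨_, _, h, _⟩ := hsub ha
    exact h
  refine ⟨sdiff_eq_empty.2 fun c hc => ⟨c, hcomp hc, le_rfl⟩, ?_⟩
  rintro N ⟨⟨hN, -, hup⟩, -⟩
  have hNA : N ⊆ A := hN.trans hcomp
  refine hNA.antisymm fun a ha => ?_
  obtain ⟨n, hn, hna⟩ := hup ha
  rwa [← hanti.eq (hNA hn) ha hna]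
end

section
/- Let L be a join-semilattice with finite connected decompositions, let (A, B) be a finite duality in L, and let r ∈ B. Then the set M of minimal elements of {x ∈ A_Cn : ¬(x ≤ r)} is a quasitransversal of A, and for every transversal M_r of A with M ⊴ M_r one has r(M_r) = r. -/
open Set

/-- A connected element below a finite supremum is below one of its members. -/
theorem ConnectedElt.exists_le_of_le_sup' {L : Type*} [SemilatticeSup L] {c : L}
    (hc : ConnectedElt c) {F : Finset L} (hF : F.Nonempty) (h : c ≤ F.sup' hF id) :
    ∃ f ∈ F, c ≤ f := by
  induction hF using Finset.Nonempty.cons_induction with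
  | singleton a => exact ⟨a, by simp, by simpa using h⟩
  | cons a s ha hs ih =>
    rw [Finset.sup'_cons hs] at h
    rcases hc _ _ h with h | h
    · exact ⟨a, by simp, h⟩
    · obtain ⟨f, hf, hcf⟩ := ih h
      exact ⟨f, by simp [hf], hcf⟩

theorem IsConnComponent.le {L : Type*} [SemilatticeSup L] {c a : L}
    (h : IsConnComponent c a) : c ≤ a := by
  rcases h.2 with rfl | ⟨b, rfl, -⟩
  · exact le_rfl
  · exact le_sup_right

/-- Every connected component of `a` occurs in each connected decomposition of `a`. -/
theorem IsConnComponent.mem_of_sup'_eq {L : Type*} [SemilatticeSup L] {c a : L}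
    (h : IsConnComponent c a) {F : Finset L} (hF : F.Nonempty)
    (hconn : ∀ f ∈ F, ConnectedElt f) (hsup : F.sup' hF id = a) : c ∈ F := by
  obtain ⟨f, hf, hcf⟩ := h.1.exists_le_of_le_sup' hF (hsup ▸ h.le)
  have hfa : f ≤ a := hsup ▸ Finset.le_sup' id hf
  rcases h.2 with rfl | ⟨b, rfl, hb⟩
  · rwa [hcf.antisymm hfa]
  · rcases hconn f hf _ _ hfa with hfb | hfc
    · exact absurd (sup_eq_left.2 (hcf.trans hfb)) hb
    · rwa [hcf.antisymm hfc]

/-- The maximal members of a connected decomposition of `a` are connected components of `a`. -/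
theorem isConnComponent_of_maximal {L : Type*} [SemilatticeSup L] {g a : L} {F : Finset L}
    (hF : F.Nonempty) (hconn : ∀ f ∈ F, ConnectedElt f) (hsup : F.sup' hF id = a)
    (hg : Maximal (· ∈ F) g) : IsConnComponent g a := by
  classical
  refine ⟨hconn g hg.1, ?_⟩
  have hga : g ≤ a := hsup ▸ Finset.le_sup' id hg.1
  rcases (F.erase g).eq_empty_or_nonempty with he | hne
  · refine Or.inl (hga.antisymm ?_)
    rw [← hsup]
    refine Finset.sup'_le hF id fun f hf => ?_
    by_contra hfg
    have hmem : f ∈ F.erase g := Finset.mem_erase.2 ⟨fun h => hfg h.le, hf⟩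
    simp [he] at hmem
  · refine Or.inr ⟨(F.erase g).sup' hne id, le_antisymm ?_ (sup_le ?_ hga), fun h => ?_⟩
    · rw [← hsup]
      refine Finset.sup'_le hF id fun f hf => ?_
      by_cases hfg : f = g
      · exact hfg.le.trans le_sup_right
      · exact (Finset.le_sup' id (Finset.mem_erase.2 ⟨hfg, hf⟩)).trans le_sup_left
    · rw [← hsup]
      exact Finset.sup'_mono id (Finset.erase_subset g F) hne
    · obtain ⟨f, hf, hgf⟩ :=
        (hconn g hg.1).exists_le_of_le_sup' hne (sup_eq_left.1 h)
      obtain ⟨hfg, hfF⟩ := Finset.mem_erase.1 hf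
      exact hfg ((hg.2 hfF hgf).antisymm hgf)

theorem finite_connComponents {L : Type*} [SemilatticeSup L]
    (hL : HasFiniteConnectedDecompositions L) {A : Set L} (hA : A.Finite) :
    (connComponents A).Finite := by
  have hunion : connComponents A = ⋃ a ∈ A, {c | IsConnComponent c a} := by
    ext c
    simp [connComponents]
  rw [hunion]
  refine hA.biUnion fun a _ => ?_
  obtain ⟨F, hF, hconn, hsup⟩ := hL a
  exact F.finite_toSet.subset fun c hc => hc.mem_of_sup'_eq hF hconn hsup

/-- An element not below `r` has a connected component not below `r`. -/
theorem exists_isConnComponent_not_le {L : Type*} [SemilatticeSup L]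
    (hL : HasFiniteConnectedDecompositions L) {a r : L} (har : ¬ a ≤ r) :
    ∃ c, IsConnComponent c a ∧ ¬ c ≤ r := by
  obtain ⟨F, hF, hconn, hsup⟩ := hL a
  have hex : ∃ f ∈ F, ¬ f ≤ r := by
    by_contra! hle
    exact har (hsup ▸ Finset.sup'_le hF id hle)
  obtain ⟨f, hf, hfr⟩ := hex
  obtain ⟨g, hfg, hg⟩ := F.finite_toSet.exists_le_maximal hf
  exact ⟨g, isConnComponent_of_maximal hF hconn hsup hg, fun hgr => hfr (hfg.trans hgr)⟩

/-- for `r ∈ B`, the set of minimal elements of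
`{x ∈ A_Cn : ¬ x ≤ r}` is a quasitransversal of `A`, and every transversal
`M_r` coarser than it has `r(M_r) = r` (i.e. `r` satisfies the defining
properties of `r(M_r)`). -/
theorem min_nonbelow_is_quasitransversal {L : Type*} [SemilatticeSup L]
    (hL : HasFiniteConnectedDecompositions L) (A B : Set L)
    (hAB : FiniteDuality A B) (r : L) (hr : r ∈ B) :
    IsQuasitransversal
      {x | (x ∈ connComponents A ∧ ¬ x ≤ r) ∧
        ∀ y, (y ∈ connComponents A ∧ ¬ y ≤ r) → y ≤ x → y = x} A ∧
    ∀ M_r : Set L, IsTransversal M_r A →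
      M_r ⊆ upSet {x | (x ∈ connComponents A ∧ ¬ x ≤ r) ∧
        ∀ y, (y ∈ connComponents A ∧ ¬ y ≤ r) → y ≤ x → y = x} →
      M_r ∩ downSet {r} = ∅ ∧ connComponents A \ upSet M_r ⊆ downSet {r} := by
  obtain ⟨hA, -, -, hB, hdual⟩ := hAB
  refine ⟨⟨fun x hx => hx.1.1, fun x hx y hy hne hxy => hne (hy.2 x hx.1 hxy),
    fun a ha => ?_⟩, fun M_r hM hsub => ?_⟩
  · have har : ¬ a ≤ r := fun h => (hdual a).1 ⟨a, ha, le_rfl⟩ ⟨r, hr, h⟩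
    obtain ⟨c, hca, hcr⟩ := exists_isConnComponent_not_le hL har
    have hfin : {x | x ∈ connComponents A ∧ ¬ x ≤ r}.Finite :=
      (finite_connComponents hL hA).subset fun x hx => hx.1
    obtain ⟨m, hmc, hm⟩ := hfin.exists_le_minimal (a := c) ⟨⟨a, ha, hca⟩, hcr⟩
    exact ⟨m, ⟨hm.1, fun y hy hym => hym.antisymm (hm.2 hy hym)⟩, hmc.trans hca.le⟩
  · have hnle : ∀ m ∈ M_r, ¬ m ≤ r := fun m hm hmr => by
      obtain ⟨x, hx, hxm⟩ := hsub hm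
      exact hx.1.2 (hxm.trans hmr)
    refine ⟨?_, fun c ⟨_, hc⟩ => ⟨r, rfl, ?_⟩⟩
    · ext m
      simpa [downSet] using hnle m
    · have hbelow : ∃ b ∈ B, c ⊔ r ≤ b := by
        by_contra hno
        obtain ⟨a, ha, hle⟩ := (hdual _).2 hno
        obtain ⟨m, hm, hma⟩ := hM.1.2.2 ha
        obtain ⟨_, _, hmconn, -⟩ := hM.1.1 hm
        rcases hmconn _ _ (hma.trans hle) with h | h
        · exact hc ⟨m, hm, h⟩
        · exact hnle m hm h
      obtain ⟨b, hb, hle⟩ := hbelow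
      rw [hB.eq hr hb (le_sup_right.trans hle)]
      exact le_sup_left.trans hle
end
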